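/- arXiv:2407.18167 — 2 statements merged into one kernel-verified Lean document; each statement's English description precedes it below -/
import Mathlib

section
/- Let G be an idempotent trivial reflexive digraph such that the identity is an isolated loop in Hom(G,G), and let f : G^p → G (p ≥ 2) be a surjective polymorphism. If there exists an embedding e : G ↪ G^p such that the restriction of f to the image e(G) is surjective onto G, then f is essentially unary. -/
/-- A map is a digraph homomorphism if it sends arcs to arcs. -/
def IsHom {V W : Type*} (E : V → V → Prop) (F : W → W → Prop) (f : V → W) : Prop :=
  ∀ x y, E x y → F (f x) (f y)

/-- The arc relation of the `p`-th power digraph (componentwise arcs). -/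
def PowE {V : Type*} (E : V → V → Prop) (p : ℕ) : (Fin p → V) → (Fin p → V) → Prop :=
  fun x y => ∀ i, E (x i) (y i)

/-- A `p`-ary operation is essentially unary: it factors as a homomorphism applied
to one coordinate. -/
def EssUnary {V : Type*} (E : V → V → Prop) {p : ℕ} (f : (Fin p → V) → V) : Prop :=
  ∃ (i : Fin p) (g : V → V), IsHom E E g ∧ ∀ x, f x = g (x i)

/-- The arc relation of the digraph `Hom(G,H)`: `(f,g)` is an arc if `(f x, g y)` is an
arc of `H` whenever `(x,y)` is an arc of `G`. -/
def HomArc {V W : Type*} (E : V → V → Prop) (F : W → W → Prop) (f g : V → W) : Prop :=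
  ∀ x y, E x y → F (f x) (g y)

/-- A digraph is Słupecki if every surjective `k`-ary polymorphism (`k ≥ 2`) is
essentially unary. -/
def IsSlupecki {V : Type*} (E : V → V → Prop) : Prop :=
  ∀ k : ℕ, 2 ≤ k → ∀ f : (Fin k → V) → V,
    IsHom (PowE E k) E f → Function.Surjective f → EssUnary E f

/-- A digraph is idempotent trivial if every idempotent `p`-ary polymorphism (`p ≥ 2`)
is a projection. -/
def IdemTrivial {V : Type*} (E : V → V → Prop) : Prop :=
  ∀ p : ℕ, 2 ≤ p → ∀ f : (Fin p → V) → V, IsHom (PowE E p) E f →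
    (∀ x : V, f (fun _ => x) = x) → ∃ i : Fin p, ∀ x, f x = x i

/-- Directed reachability inside the digraph `Hom(G,H)` (all intermediate vertices are
homomorphisms). -/
def HomReach {V W : Type*} (E : V → V → Prop) (F : W → W → Prop) :
    (V → W) → (V → W) → Prop :=
  Relation.ReflTransGen (fun a b => IsHom E F a ∧ IsHom E F b ∧ HomArc E F a b)

/-- Reachability inside the symmetrization of the digraph `Hom(G,H)` (connected
components). -/
def HomSymReach {V W : Type*} (E : V → V → Prop) (F : W → W → Prop) :
    (V → W) → (V → W) → Prop :=
  Relation.ReflTransGen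
    (fun a b => IsHom E F a ∧ IsHom E F b ∧ (HomArc E F a b ∨ HomArc E F b a))

theorem IsHom.perm_symm {V : Type*} [Finite V] {E : V → V → Prop} {s : Equiv.Perm V}
    (hs : IsHom E E s) : IsHom E E s.symm := by
  have hpow : ∀ n : ℕ, IsHom E E (s ^ n : Equiv.Perm V) := by
    intro n
    induction n with
    | zero => exact fun x y h => h
    | succ n ih =>
      intro x y h
      rw [pow_succ, Equiv.Perm.mul_apply, Equiv.Perm.mul_apply]
      exact ih _ _ (hs _ _ h)
  obtain ⟨n, hn⟩ : ∃ n : ℕ, s ^ n = s⁻¹ :=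
    mem_powers_iff_mem_zpowers.2 (inv_mem (Subgroup.mem_zpowers s))
  have h := hpow n
  rwa [hn] at h

/-- An idempotent trivial digraph is connected: a property invariant along arcs holds either
everywhere or nowhere. -/
theorem IdemTrivial.forall_of_exists {V : Type*} {E : V → V → Prop} (hIT : IdemTrivial E)
    {P : V → Prop} (hP : ∀ x y, E x y → (P x ↔ P y)) {a : V} (ha : P a) (b : V) : P b := by
  classical
  by_contra hb
  obtain ⟨i, hi⟩ := hIT 2 le_rfl (fun x => if P (x 0) then x 0 else x 1) (by
    intro x y h
    have h0 := hP _ _ (h 0)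
    by_cases hx : P (x 0)
    · simpa only [if_pos hx, if_pos (h0.1 hx)] using h 0
    · simpa only [if_neg hx, if_neg (fun hy => hx (h0.2 hy))] using h 1) (by simp)
  have hab : a ≠ b := fun h => hb (h ▸ ha)
  fin_cases i
  · exact hab (by simpa [hb] using hi ![b, a])
  · exact hab (by simpa [ha] using hi ![a, b])

/-- In a power of an idempotent trivial reflexive digraph, a property invariant along arcs which
holds somewhere holds everywhere. -/
theorem IdemTrivial.forall_pow_of_exists {V : Type*} {E : V → V → Prop}
    (hrefl : ∀ x, E x x) (hIT : IdemTrivial E) {p : ℕ} {P : (Fin p → V) → Prop}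
    (hP : ∀ x y, PowE E p x y → (P x ↔ P y)) {a : Fin p → V} (ha : P a) (b : Fin p → V) :
    P b := by
  classical
  have key : ∀ s : Finset (Fin p), P (s.piecewise b a) := by
    intro s
    induction s using Finset.induction_on with
    | empty => simpa using ha
    | insert j s _ ih =>
      rw [Finset.piecewise_insert]
      refine hIT.forall_of_exists (P := fun v => P (Function.update (s.piecewise b a) j v))
        (fun x y h => hP _ _ fun i => ?_) (a := s.piecewise b a j) (by simpa using ih) (b j)
      by_cases hi : i = j
      · subst hi
        simpa using h
      · simpa [hi] using hrefl _
  simpa using key Finset.univ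

theorem stmt1 {V : Type*} [Fintype V] [Nonempty V] (E : V → V → Prop)
    (hrefl : ∀ x, E x x)
    (hIT : IdemTrivial E)
    (hid : ∀ h : V → V, IsHom E E h → (HomArc E E h id ∨ HomArc E E id h) → h = id)
    (p : ℕ) (hp : 2 ≤ p) (f : (Fin p → V) → V)
    (hf : IsHom (PowE E p) E f) (hsurj : Function.Surjective f)
    (e : V → Fin p → V) (hinj : Function.Injective e)
    (hemb : ∀ x y, PowE E p (e x) (e y) ↔ E x y)
    (hres : ∀ z : V, ∃ x : V, f (e x) = z) :
    EssUnary E f := by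
  classical
  let s : Equiv.Perm V :=
    Equiv.ofBijective (fun x => f (e x)) (Finite.surjective_iff_bijective.1 hres)
  have hs : ∀ x, s x = f (e x) := fun _ => rfl
  have hs_symm : IsHom E E s.symm :=
    IsHom.perm_symm fun x y h => hf _ _ ((hemb x y).2 h)
  have he : ∀ i x y, E x y → E (e x i) (e y i) := fun i x y h => (hemb x y).2 h i
  obtain ⟨i, hi⟩ := hIT p hp (fun x => s.symm (f fun j => e (x j) j))
    (fun x y h => hs_symm _ _ (hf _ _ fun j => he j _ _ (h j)))
    (fun x => by rw [Equiv.symm_apply_eq, hs])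
  have hei : Function.Injective fun x => e x i := by
    intro x y hxy
    obtain ⟨c⟩ := ‹Nonempty V›
    have hx := hi (Function.update (fun _ => c) i x)
    have hy := hi (Function.update (fun _ => c) i y)
    rw [Function.update_self] at hx hy
    rw [← hx, ← hy]
    congr 2
    funext j
    by_cases hj : j = i
    · subst hj
      simpa using hxy
    · simp [hj]
  let H : (Fin p → V) → V → V := fun z x => s.symm (f (Function.update z i (e x i)))
  have harc : ∀ z w, PowE E p z w → HomArc E E (H z) (H w) := by
    intro z w hzw x y hxy
    refine hs_symm _ _ (hf _ _ fun j => ?_)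
    by_cases hj : j = i
    · subst hj
      simpa using he _ _ _ hxy
    · simpa [hj] using hzw j
  have hhom : ∀ z, IsHom E E (H z) := fun z => harc z z fun j => hrefl _
  have hH : ∀ z, H z = id := by
    obtain ⟨c⟩ := ‹Nonempty V›
    refine hIT.forall_pow_of_exists hrefl (P := fun z => H z = id) (a := e c) ?_ ?_
    · intro z w hzw
      have h := harc z w hzw
      exact ⟨fun hz => hid _ (hhom w) (.inr (hz ▸ h)), fun hw => hid _ (hhom z) (.inl (hw ▸ h))⟩
    · funext x
      have hx := hi (Function.update (fun _ => c) i x)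
      rw [Function.update_self] at hx
      refine Eq.trans ?_ hx
      simp only [H]
      congr 2
      funext j
      by_cases hj : j = i
      · subst hj
        simp
      · simp [hj]
  refine ⟨i, fun v => f fun _ => v, fun x y h => hf _ _ fun _ => h, fun w => ?_⟩
  obtain ⟨x, hx⟩ := Finite.injective_iff_surjective.1 hei (w i)
  have hval : ∀ z : Fin p → V, z i = w i → f z = s x := by
    intro z hz
    have h : s.symm (f (Function.update z i (e x i))) = x := congrFun (hH z) x
    have hx' : e x i = z i := hx.trans hz.symm
    rwa [hx', Function.update_eq_self, Equiv.symm_apply_eq] at h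
  rw [hval w rfl]
  exact (hval (fun _ => w i) rfl).symm
end

section
/- For every n ≥ 3, let H_n be the reflexive digraph on vertices Z/nZ whose arcs are all loops together with all arcs (i,j) with i ≠ j except the arcs (i, i+1) for each i ∈ Z/nZ (the complete digraph minus a directed Hamiltonian cycle). Then H_n is Słupecki. -/
/-- A function of finitely many variables that is unchanged by every one-coordinate update
is constant. -/
theorem eq_of_forall_update_eq {ι α β : Type*} [Finite ι] [DecidableEq ι] {f : (ι → α) → β}
    (h : ∀ x i a, f (Function.update x i a) = f x) (x y : ι → α) : f x = f y := by
  have := Fintype.ofFinite ι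
  have key : ∀ s : Finset ι, f (s.piecewise x y) = f y := by
    intro s
    induction s using Finset.induction_on with
    | empty => simp
    | insert i s _ ih => rw [Finset.piecewise_insert, h, ih]
  simpa using key Finset.univ

/-- If a surjective operation depends on the `i`-th coordinate and on another one, then it takes
three distinct values on some `x`, on a point differing from `x` only at `i`, and on a point
agreeing with `x` at `i`. -/
theorem exists_three_values {ι α β : Type*} [DecidableEq ι] {f : (ι → α) → β}
    (hf : Function.Surjective f) (hβ : ∀ u v : β, ∃ w, w ≠ u ∧ w ≠ v) {i : ι}
    (hi : ∃ x a, f (Function.update x i a) ≠ f x)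
    (hi' : ∃ x y, x i = y i ∧ f x ≠ f y) :
    ∃ x y a, y i = x i ∧ f (Function.update x i a) ≠ f x ∧ f y ≠ f x ∧
      f y ≠ f (Function.update x i a) := by
  by_cases hfull : ∀ x, (∃ a, f (Function.update x i a) ≠ f x) →
      ∀ v, ∃ a, f (Function.update x i a) = v
  · obtain ⟨x, y, hxy, hne⟩ := hi'
    have key : ∀ x y, y i = x i → f y ≠ f x → (∃ a, f (Function.update x i a) ≠ f x) →
        ∃ x y a, y i = x i ∧ f (Function.update x i a) ≠ f x ∧ f y ≠ f x ∧
          f y ≠ f (Function.update x i a) := by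
      intro x y hyx hne hx
      obtain ⟨w, hwx, hwy⟩ := hβ (f x) (f y)
      obtain ⟨a, rfl⟩ := hfull x hx w
      exact ⟨x, y, a, hyx, hwx, hne, hwy.symm⟩
    obtain ⟨e, b, hb⟩ := hi
    have he : ∃ a, f (Function.update (Function.update e i (x i)) i a) ≠
        f (Function.update e i (x i)) := by
      simp only [Function.update_idem]
      by_contra! hcon
      exact hb ((hcon b).trans (by rw [← hcon (e i), Function.update_eq_self]))
    by_cases hex : f x = f (Function.update e i (x i))
    · exact key _ y (by simp [hxy]) (by rw [← hex]; exact hne.symm) he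
    · exact key _ x (by simp) hex he
  · push Not at hfull
    obtain ⟨x, ⟨a, ha⟩, v, hv⟩ := hfull
    obtain ⟨y, rfl⟩ := hf v
    have hex : ∃ b, f (Function.update x i b) ≠ f (Function.update x i (y i)) := by
      by_cases hx : f x = f (Function.update x i (y i))
      · exact ⟨a, hx ▸ ha⟩
      · exact ⟨x i, by rwa [Function.update_eq_self]⟩
    obtain ⟨b, hb⟩ := hex
    exact ⟨Function.update x i (y i), y, b, by simp, by simpa using hb, (hv _).symm,
      by simpa using (hv b).symm⟩

theorem stmt15 (n : ℕ) (hn : 3 ≤ n) :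
    IsSlupecki (fun i j : ZMod n => i = j ∨ (i ≠ j ∧ j ≠ i + 1)) := by
  have : NeZero n := ⟨by omega⟩
  have : Fact (1 < n) := ⟨by omega⟩
  have hthree : ∀ u v : ZMod n, ∃ w, w ≠ u ∧ w ≠ v := by
    intro u v
    have hlt : ({u, v} : Finset (ZMod n)).card < (Finset.univ : Finset (ZMod n)).card := by
      rw [Finset.card_univ, ZMod.card]
      exact Finset.card_le_two.trans_lt hn
    obtain ⟨w, -, hw⟩ := Finset.exists_mem_notMem_of_card_lt_card hlt
    exact ⟨w, by simpa using hw⟩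
  intro k _ f hf hsurj
  by_cases hun : ∃ i, ∀ x y, x i = y i → f x = f y
  · obtain ⟨i, hi⟩ := hun
    exact ⟨i, fun a => f fun _ => a, fun a b hab => hf _ _ fun _ => hab, fun x => hi _ _ rfl⟩
  exfalso
  push Not at hun
  obtain ⟨i, hi⟩ : ∃ i, ∃ x a, f (Function.update x i a) ≠ f x := by
    by_contra! hcon
    obtain ⟨x, hx⟩ := hsurj 0
    obtain ⟨y, hy⟩ := hsurj 1
    have hxy := eq_of_forall_update_eq (fun x i a => hcon i x a) x y
    rw [hx, hy] at hxy
    exact zero_ne_one hxy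
  obtain ⟨x, y, a, hyx, hzx, hyx', hyz⟩ := exists_three_values hsurj hthree hi (hun i)
  -- A transversal of the fibres of `f` none of whose coordinates is injective.
  obtain ⟨p, hp, hpx, hpz, hpy⟩ : ∃ p : ZMod n → Fin k → ZMod n, (∀ c, f (p c) = c) ∧
      p (f x) = x ∧ p (f (Function.update x i a)) = Function.update x i a ∧ p (f y) = y := by
    choose q hq using hsurj
    refine ⟨Function.update (Function.update (Function.update q (f x) x)
      (f (Function.update x i a)) (Function.update x i a)) (f y) y, fun c => ?_, ?_, ?_, ?_⟩
    · simp only [Function.update_apply]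
      split_ifs <;> simp_all
    · rw [Function.update_of_ne hyx'.symm, Function.update_of_ne hzx.symm,
        Function.update_self]
    · rw [Function.update_of_ne hyz.symm, Function.update_self]
    · rw [Function.update_self]
  have hmiss : ∀ j, ∃ u, ∀ c, p c j ≠ u + 1 := by
    intro j
    have hns : ¬ Function.Surjective fun c => p c j := by
      intro hs
      have hinj := Finite.injective_iff_surjective.mpr hs
      by_cases hj : j = i
      · subst hj
        exact hyx' (hinj (by simp only [hpx, hpy, hyx]))
      · exact hzx (hinj (by simp only [hpx, hpz, Function.update_of_ne hj]))
    rw [Function.Surjective] at hns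
    push Not at hns
    obtain ⟨v, hv⟩ := hns
    exact ⟨v - 1, by simpa using hv⟩
  choose u hu using hmiss
  have harc := hf u (p (f u + 1)) fun j => by
    by_cases h : u j = p (f u + 1) j
    · exact Or.inl h
    · exact Or.inr ⟨h, hu j _⟩
  simp [hp] at harc
end
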